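/- arXiv:1701.07130 — 2 statements merged into one kernel-verified Lean document; each statement's English description precedes it below -/
import Mathlib

section
/- Fix p ∈ (0,1) and a function h : ℕ → ℕ. For a vector ĵ = (j₁,…,j_D) of nonnegative integers, let NMon(n,D,h,ĵ) be the number of monomial ideals I ⊆ S, all of whose minimal generators have degree at most D, such that h_I(d) = h(d) for all d ≥ 1 and β_{1,d}(S/I) = j_d for all 1 ≤ d ≤ D. Then the probability that the random monomial ideal 𝔍 of the ER-type model satisfies h_𝔍(d) = h(d) for all d ≥ 1 equals the finite sum Σ_ĵ NMon(n,D,h,ĵ) · p^{j₁+⋯+j_D} · (1−p)^{Σ_{d=1}^{D} h(d)}, where ĵ ranges over all vectors with j_d at most the number of monomials of degree exactly d in n variables, for each 1 ≤ d ≤ D. -/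
open Finset MvPolynomial Filter

noncomputable section

/-- The set of exponent vectors of nonconstant monomials in `n` variables of total degree
at most `D`. -/
def monSet (n D : ℕ) : Finset (Fin n → ℕ) :=
  (Fintype.piFinset fun _ : Fin n => Finset.range (D + 1)).filter
    fun α => 0 < ∑ i, α i ∧ ∑ i, α i ≤ D

/-- The monomial `x^α` of `MvPolynomial (Fin n) K` with exponent vector `α`. -/
def mono (K : Type*) [CommRing K] {n : ℕ} (α : Fin n → ℕ) : MvPolynomial (Fin n) K :=
  MvPolynomial.monomial (Finsupp.equivFunOnFinite.symm α) 1

/-- The monomial ideal generated by a set of exponent vectors. -/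
def idealOf (K : Type*) [CommRing K] {n : ℕ} (B : Finset (Fin n → ℕ)) :
    Ideal (MvPolynomial (Fin n) K) :=
  Ideal.span (mono K '' (B : Set (Fin n → ℕ)))

open Classical in
/-- The probability, under the ER-type model `ℐ(n,D,p)`, of the event `E` on random
generating sets `𝔅 ⊆ M(n,D)`. -/
def ERprob (n D : ℕ) (p : ℝ) (E : Set (Finset (Fin n → ℕ))) : ℝ :=
  ∑ B ∈ (monSet n D).powerset.filter (· ∈ E),
    p ^ B.card * (1 - p) ^ ((monSet n D).card - B.card)

/-- `I` is a monomial ideal. -/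
def IsMonomialIdeal (K : Type*) [CommRing K] {n : ℕ}
    (I : Ideal (MvPolynomial (Fin n) K)) : Prop :=
  ∃ G : Set (Fin n → ℕ), I = Ideal.span (mono K '' G)

/-- `x^α` is a minimal monomial generator of `I`: it lies in `I` and no proper divisor does. -/
def IsMinGen (K : Type*) [CommRing K] {n : ℕ} (I : Ideal (MvPolynomial (Fin n) K))
    (α : Fin n → ℕ) : Prop :=
  mono K α ∈ I ∧ ∀ β : Fin n → ℕ, (∀ i, β i ≤ α i) → β ≠ α → mono K β ∉ I

/-- `β₁(S/I)`: the number of minimal monomial generators of `I`. -/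
def beta1 (K : Type*) [CommRing K] {n : ℕ} (I : Ideal (MvPolynomial (Fin n) K)) : ℕ :=
  {α : Fin n → ℕ | IsMinGen K I α}.ncard

/-- `β_{1,d}(S/I)`: the number of minimal monomial generators of `I` of degree `d`. -/
def beta1d (K : Type*) [CommRing K] {n : ℕ} (I : Ideal (MvPolynomial (Fin n) K)) (d : ℕ) : ℕ :=
  {α : Fin n → ℕ | IsMinGen K I α ∧ ∑ i, α i = d}.ncard

/-- `h_I(d)`: the number of monomials of degree exactly `d` not contained in `I`. -/
def hilb (K : Type*) [CommRing K] {n : ℕ} (I : Ideal (MvPolynomial (Fin n) K)) (d : ℕ) : ℕ :=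
  {α : Fin n → ℕ | ∑ i, α i = d ∧ mono K α ∉ I}.ncard

/-- `NMon(n,D,h,ĵ)`: the number of proper monomial ideals of `S = K[x₁,…,xₙ]`, all of whose
minimal generators have degree at most `D`, with Hilbert function `h` in all degrees `d ≥ 1`,
and with exactly `j d` minimal generators of degree `d + 1` for each `d : Fin D`. -/
def NMon (K : Type*) [Field K] (n D : ℕ) (h : ℕ → ℕ) (j : Fin D → ℕ) : ℕ :=
  {I : Ideal (MvPolynomial (Fin n) K) | IsMonomialIdeal K I ∧ I ≠ ⊤ ∧
    (∀ α : Fin n → ℕ, IsMinGen K I α → ∑ i, α i ≤ D) ∧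
    (∀ d : ℕ, 1 ≤ d → hilb K I d = h d) ∧
    (∀ d : Fin D, beta1d K I (d.1 + 1) = j d)}.ncard

/-- Summing the product Bernoulli weights on subsets of `M` over the interval `[G, A]`. -/
theorem sum_Icc_bernoulli {ι : Type*} [DecidableEq ι] {G A M : Finset ι} (hGA : G ⊆ A) (hAM : A ⊆ M) (p : ℝ) :
    ∑ B ∈ Finset.Icc G A, p ^ B.card * (1 - p) ^ (M.card - B.card) =
      p ^ G.card * (1 - p) ^ (M \ A).card := by
  have hinj : Set.InjOn (G ∪ ·) ((A \ G).powerset : Set (Finset ι)) := by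
    intro s hs t ht hst
    simp only [Finset.coe_powerset, Set.mem_preimage, Set.mem_powerset_iff,
      Finset.coe_subset] at hs ht
    have hsd : ∀ u ⊆ A \ G, (G ∪ u) \ G = u := fun u hu => by
      rw [Finset.union_sdiff_cancel_left]
      exact Finset.disjoint_of_subset_right hu Finset.disjoint_sdiff
    rw [← hsd s hs, ← hsd t ht]
    exact congrArg (· \ G) hst
  have hterm : ∀ C ∈ (A \ G).powerset,
      p ^ (G ∪ C).card * (1 - p) ^ (M.card - (G ∪ C).card) =
        p ^ G.card * (1 - p) ^ (M \ A).card *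
          (p ^ C.card * (1 - p) ^ ((A \ G).card - C.card)) := by
    intro C hC
    rw [Finset.mem_powerset] at hC
    have hcard : (G ∪ C).card = G.card + C.card :=
      Finset.card_union_of_disjoint (Finset.disjoint_of_subset_right hC Finset.disjoint_sdiff)
    have hCle := Finset.card_le_card hC
    have h₁ := Finset.card_sdiff_add_card_eq_card hGA
    have h₂ := Finset.card_sdiff_add_card_eq_card hAM
    have hexp : M.card - (G ∪ C).card = (M \ A).card + ((A \ G).card - C.card) := by omega
    rw [hexp, hcard, pow_add, pow_add]
    ring
  rw [Finset.Icc_eq_image_powerset hGA, Finset.sum_image hinj, Finset.sum_congr rfl hterm,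
    ← Finset.mul_sum, Finset.sum_pow_mul_eq_add_pow]
  simp

theorem mem_monSet {n D : ℕ} {α : Fin n → ℕ} :
    α ∈ monSet n D ↔ 0 < ∑ i, α i ∧ ∑ i, α i ≤ D := by
  simp only [monSet, Finset.mem_filter, Fintype.mem_piFinset, Finset.mem_range,
    and_iff_right_iff_imp]
  rintro ⟨-, h⟩ i
  have := Finset.single_le_sum (f := α) (fun _ _ => Nat.zero_le _) (Finset.mem_univ i)
  omega

theorem finite_setOf_sum_eq (n d : ℕ) : {α : Fin n → ℕ | ∑ i, α i = d}.Finite := by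
  refine (Set.finite_Iic (fun _ : Fin n => d)).subset fun α hα i => ?_
  rw [← Set.mem_ofPred_eq.mp hα]
  exact Finset.single_le_sum (f := α) (fun _ _ => Nat.zero_le _) (Finset.mem_univ i)

theorem ncard_setOf_sum_eq {n : ℕ} (hn : 1 ≤ n) (d : ℕ) :
    {α : Fin n → ℕ | ∑ i, α i = d}.ncard = (n - 1 + d).choose d := by
  have h := Nat.card_congr (Sym.equivNatSumOfFintype (Fin n) d)
  rw [Nat.card_eq_fintype_card, Sym.card_sym_eq_choose, Fintype.card_fin] at h
  rw [← Nat.card_coe_set_eq]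
  refine h.symm.trans ?_
  congr 1
  omega

theorem mono_mem_span_iff (K : Type*) [Field K] {n : ℕ} {G : Set (Fin n → ℕ)} {α : Fin n → ℕ} :
    mono K α ∈ Ideal.span (mono K '' G) ↔ ∃ β ∈ G, β ≤ α := by
  have himage : mono K '' G =
      (fun s => monomial s (1 : K)) '' (Finsupp.equivFunOnFinite.symm '' G) := by
    rw [Set.image_image]; rfl
  rw [himage, mem_ideal_span_monomial_image]
  have hsupp : (mono K α).support = {Finsupp.equivFunOnFinite.symm α} := by
    classical
    rw [mono, support_monomial, if_neg one_ne_zero]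
  rw [hsupp]
  simp only [Finset.mem_singleton, forall_eq, Set.exists_mem_image]
  rfl

section

variable {K : Type*} [Field K] {n : ℕ} {I J : Ideal (MvPolynomial (Fin n) K)}

theorem IsMonomialIdeal.mono_mem_of_le (hI : IsMonomialIdeal K I) {α β : Fin n → ℕ}
    (hβ : mono K β ∈ I) (hle : β ≤ α) : mono K α ∈ I := by
  obtain ⟨G, rfl⟩ := hI
  rw [mono_mem_span_iff] at hβ ⊢
  obtain ⟨γ, hγ, hγβ⟩ := hβ
  exact ⟨γ, hγ, hγβ.trans hle⟩

theorem IsMonomialIdeal.le_of_mono_mem (hI : IsMonomialIdeal K I)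
    (h : ∀ α : Fin n → ℕ, mono K α ∈ I → mono K α ∈ J) : I ≤ J := by
  obtain ⟨G, rfl⟩ := hI
  rw [Ideal.span_le]
  rintro _ ⟨α, hα, rfl⟩
  exact h α (Ideal.subset_span ⟨α, hα, rfl⟩)

theorem isMonomialIdeal_idealOf (B : Finset (Fin n → ℕ)) : IsMonomialIdeal K (idealOf K B) :=
  ⟨B, rfl⟩

theorem mono_mem_idealOf_iff {B : Finset (Fin n → ℕ)} {α : Fin n → ℕ} :
    mono K α ∈ idealOf K B ↔ ∃ β ∈ B, β ≤ α :=
  mono_mem_span_iff K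

theorem IsMinGen.mem_of_idealOf {B : Finset (Fin n → ℕ)} {α : Fin n → ℕ}
    (h : IsMinGen K (idealOf K B) α) : α ∈ B := by
  obtain ⟨β, hβ, hle⟩ := mono_mem_idealOf_iff.mp h.1
  by_contra hα
  exact h.2 β hle (fun hne => hα (hne ▸ hβ)) (mono_mem_idealOf_iff.mpr ⟨β, hβ, le_rfl⟩)

theorem exists_isMinGen_le {α : Fin n → ℕ} (h : mono K α ∈ I) :
    ∃ β ≤ α, IsMinGen K I β := by
  induction α using WellFoundedLT.induction with
  | _ α ih =>
    by_cases hα : IsMinGen K I α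
    · exact ⟨α, le_rfl, hα⟩
    · simp only [IsMinGen, h, true_and, not_forall, not_not] at hα
      obtain ⟨β, hle, hne, hβ⟩ := hα
      obtain ⟨γ, hγ, hmin⟩ := ih β (lt_of_le_of_ne hle hne) hβ
      exact ⟨γ, hγ.trans hle, hmin⟩

theorem mono_zero : mono K (0 : Fin n → ℕ) = 1 := by
  have h : Finsupp.equivFunOnFinite.symm (0 : Fin n → ℕ) = 0 := by ext; rfl
  rw [mono, h]
  rfl

theorem sum_pos_of_mono_mem (hI : I ≠ ⊤) {α : Fin n → ℕ} (h : mono K α ∈ I) :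
    0 < ∑ i, α i := by
  refine Nat.pos_of_ne_zero fun h0 => hI ?_
  have : α = 0 := by
    funext i
    exact Finset.sum_eq_zero_iff.mp h0 i (Finset.mem_univ i)
  rw [this, mono_zero] at h
  exact (Ideal.eq_top_iff_one I).mpr h

theorem idealOf_ne_top {D : ℕ} {B : Finset (Fin n → ℕ)} (hB : B ⊆ monSet n D) :
    idealOf K B ≠ ⊤ := by
  intro htop
  have h : mono K 0 ∈ idealOf K B := htop ▸ Submodule.mem_top
  obtain ⟨β, hβ, hle⟩ := mono_mem_idealOf_iff.mp h
  have hpos := (mem_monSet.mp (hB hβ)).1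
  rw [le_antisymm hle (zero_le (a := β))] at hpos
  simp at hpos

open Classical in
/-- The exponents in `monSet n D` of minimal generators of `I`. -/
def minGens (D : ℕ) (I : Ideal (MvPolynomial (Fin n) K)) : Finset (Fin n → ℕ) :=
  (monSet n D).filter (IsMinGen K I)

open Classical in
/-- The exponents in `monSet n D` of monomials of `I`. -/
def monsIn (D : ℕ) (I : Ideal (MvPolynomial (Fin n) K)) : Finset (Fin n → ℕ) :=
  (monSet n D).filter (mono K · ∈ I)

theorem mem_minGens {D : ℕ} {α : Fin n → ℕ} :
    α ∈ minGens D I ↔ α ∈ monSet n D ∧ IsMinGen K I α := by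
  simp [minGens]

theorem mem_monsIn {D : ℕ} {α : Fin n → ℕ} :
    α ∈ monsIn D I ↔ α ∈ monSet n D ∧ mono K α ∈ I := by
  simp [monsIn]

theorem minGens_subset_monsIn {D : ℕ} : minGens D I ⊆ monsIn D I := fun _ hα =>
  mem_monsIn.mpr ⟨(mem_minGens.mp hα).1, (mem_minGens.mp hα).2.1⟩

theorem monsIn_subset_monSet {D : ℕ} : monsIn D I ⊆ monSet n D := fun _ hα =>
  (mem_monsIn.mp hα).1

/-- The generating sets in `monSet n D` of a monomial ideal `I` are those between the minimal
generators and all monomials of `I`. -/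
theorem subset_and_idealOf_eq_iff {D : ℕ} (hI : IsMonomialIdeal K I) (htop : I ≠ ⊤)
    (hdeg : ∀ α : Fin n → ℕ, IsMinGen K I α → ∑ i, α i ≤ D) {B : Finset (Fin n → ℕ)} :
    B ⊆ monSet n D ∧ idealOf K B = I ↔ minGens D I ⊆ B ∧ B ⊆ monsIn D I := by
  constructor
  · rintro ⟨hB, rfl⟩
    refine ⟨fun α hα => (mem_minGens.mp hα).2.mem_of_idealOf, fun α hα => ?_⟩
    exact mem_monsIn.mpr ⟨hB hα, mono_mem_idealOf_iff.mpr ⟨α, hα, le_rfl⟩⟩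
  · rintro ⟨hG, hA⟩
    refine ⟨hA.trans monsIn_subset_monSet, le_antisymm ?_ ?_⟩
    · refine (isMonomialIdeal_idealOf B).le_of_mono_mem fun α hα => ?_
      obtain ⟨β, hβ, hle⟩ := mono_mem_idealOf_iff.mp hα
      exact hI.mono_mem_of_le (mem_monsIn.mp (hA hβ)).2 hle
    · refine hI.le_of_mono_mem fun α hα => ?_
      obtain ⟨β, hle, hβ⟩ := exists_isMinGen_le hα
      refine mono_mem_idealOf_iff.mpr ⟨β, hG (mem_minGens.mpr ⟨?_, hβ⟩), hle⟩
      exact mem_monSet.mpr ⟨sum_pos_of_mono_mem htop hβ.1, hdeg β hβ⟩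

theorem card_minGens (D : ℕ) : (minGens D I).card = ∑ d : Fin D, beta1d K I (d.1 + 1) := by
  classical
  have hmaps : ∀ α ∈ minGens D I, ∑ i, α i ∈ Finset.Icc 1 D := fun α hα =>
    Finset.mem_Icc.mpr (mem_monSet.mp (mem_minGens.mp hα).1)
  rw [Finset.card_eq_sum_card_fiberwise hmaps,
    Fin.sum_univ_eq_sum_range (fun d => beta1d K I (d + 1)) D,
    ← Finset.Ico_add_one_right_eq_Icc, Finset.sum_Ico_eq_sum_range, Nat.add_sub_cancel]
  refine Finset.sum_congr rfl fun d hd => ?_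
  rw [beta1d, ← Set.ncard_coe_finset]
  congr 1
  ext α
  rw [Finset.mem_range] at hd
  simp only [Finset.coe_filter, mem_minGens, mem_monSet, Set.mem_ofPred_eq]
  grind

theorem card_monSet_sdiff_monsIn (D : ℕ) :
    (monSet n D \ monsIn D I).card = ∑ d ∈ Finset.Icc 1 D, hilb K I d := by
  classical
  have hmaps : ∀ α ∈ monSet n D \ monsIn D I, ∑ i, α i ∈ Finset.Icc 1 D := fun α hα =>
    Finset.mem_Icc.mpr (mem_monSet.mp (Finset.mem_sdiff.mp hα).1)
  rw [Finset.card_eq_sum_card_fiberwise hmaps]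
  refine Finset.sum_congr rfl fun d hd => ?_
  rw [hilb, ← Set.ncard_coe_finset]
  congr 1
  ext α
  rw [Finset.mem_Icc] at hd
  simp only [Finset.coe_filter, Finset.mem_sdiff, mem_monsIn, mem_monSet, Set.mem_ofPred_eq]
  grind

theorem beta1d_le (hn : 1 ≤ n) (d : ℕ) : beta1d K I d ≤ (n - 1 + d).choose d := by
  rw [← ncard_setOf_sum_eq hn d]
  exact Set.ncard_le_ncard (fun _ hα => hα.2) (finite_setOf_sum_eq n d)

end

/-- Theorem 2.3. The probability that the random monomial ideal of the
ER-type model has Hilbert function `h` is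
`Σ_ĵ NMon(n,D,h,ĵ) p^{j₁+⋯+j_D} (1-p)^{Σ_{d=1}^D h(d)}`, the sum over vectors `ĵ` whose
`d`-th entry is at most the number `C(n-1+d, d)` of monomials of degree `d` in `n` variables. -/
theorem stmt1 (K : Type*) [Field K] (n D : ℕ) (hn : 1 ≤ n) (hD : 1 ≤ D)
    (p : ℝ) (hp0 : 0 < p) (hp1 : p < 1) (h : ℕ → ℕ) :
    ERprob n D p {B | ∀ d : ℕ, 1 ≤ d → hilb K (idealOf K B) d = h d} =
      ∑ j ∈ Fintype.piFinset
          (fun d : Fin D => Finset.range (Nat.choose (n - 1 + (d.1 + 1)) (d.1 + 1) + 1)),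
        (NMon K n D h j : ℝ) * p ^ (∑ d, j d) *
          (1 - p) ^ (∑ d ∈ Finset.Icc 1 D, h d) := by
  classical
  let F : Finset (Ideal (MvPolynomial (Fin n) K)) :=
    ((monSet n D).powerset.image (idealOf K)).filter fun I => ∀ d, 1 ≤ d → hilb K I d = h d
  let J : Ideal (MvPolynomial (Fin n) K) → Fin D → ℕ := fun I d => beta1d K I (d.1 + 1)
  have mem_F : ∀ I, I ∈ F ↔ IsMonomialIdeal K I ∧ I ≠ ⊤ ∧
      (∀ α : Fin n → ℕ, IsMinGen K I α → ∑ i, α i ≤ D) ∧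
      ∀ d : ℕ, 1 ≤ d → hilb K I d = h d := by
    intro I
    simp only [F, Finset.mem_filter, Finset.mem_image, Finset.mem_powerset]
    constructor
    · rintro ⟨⟨B, hB, rfl⟩, hh⟩
      exact ⟨isMonomialIdeal_idealOf B, idealOf_ne_top hB,
        fun α hα => (mem_monSet.mp (hB hα.mem_of_idealOf)).2, hh⟩
    · rintro ⟨hI, htop, hdeg, hh⟩
      exact ⟨⟨minGens D I, (subset_and_idealOf_eq_iff hI htop hdeg).mpr
        ⟨subset_rfl, minGens_subset_monsIn⟩⟩, hh⟩
  have hmaps : ∀ B ∈ (monSet n D).powerset.filter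
      (· ∈ {B | ∀ d : ℕ, 1 ≤ d → hilb K (idealOf K B) d = h d}), idealOf K B ∈ F := by
    intro B hB
    rw [Finset.mem_filter] at hB
    exact Finset.mem_filter.mpr ⟨Finset.mem_image_of_mem _ hB.1, hB.2⟩
  have hfiber : ∀ I ∈ F, ∑ B ∈ ((monSet n D).powerset.filter
      (· ∈ {B | ∀ d : ℕ, 1 ≤ d → hilb K (idealOf K B) d = h d})).filter (idealOf K · = I),
        p ^ B.card * (1 - p) ^ ((monSet n D).card - B.card) =
      p ^ (∑ d, J I d) * (1 - p) ^ (∑ d ∈ Finset.Icc 1 D, h d) := by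
    intro I hIF
    obtain ⟨hI, htop, hdeg, hh⟩ := (mem_F I).mp hIF
    have hIcc : ((monSet n D).powerset.filter
        (· ∈ {B | ∀ d : ℕ, 1 ≤ d → hilb K (idealOf K B) d = h d})).filter (idealOf K · = I) =
        Finset.Icc (minGens D I) (monsIn D I) := by
      ext B
      rw [Finset.mem_Icc, ← subset_and_idealOf_eq_iff hI htop hdeg]
      simp only [Finset.mem_filter, Finset.mem_powerset, Set.mem_ofPred_eq]
      constructor
      · exact fun hB => ⟨hB.1.1, hB.2⟩
      · rintro ⟨hB, rfl⟩
        exact ⟨⟨hB, hh⟩, rfl⟩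
    rw [hIcc, sum_Icc_bernoulli minGens_subset_monsIn monsIn_subset_monSet, card_minGens,
      card_monSet_sdiff_monsIn,
      Finset.sum_congr rfl fun d hd => hh d (Finset.mem_Icc.mp hd).1]
  have hNMon : ∀ j : Fin D → ℕ, NMon K n D h j = (F.filter (J · = j)).card := by
    intro j
    rw [NMon, ← Set.ncard_coe_finset]
    congr 1
    ext I
    simp only [Finset.coe_filter, mem_F, Set.mem_ofPred_eq, J, _root_.funext_iff, and_assoc]
  have hJ : ∀ I ∈ F, J I ∈ Fintype.piFinset
      (fun d : Fin D => Finset.range (Nat.choose (n - 1 + (d.1 + 1)) (d.1 + 1) + 1)) :=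
    fun I _ => Fintype.mem_piFinset.mpr fun d =>
      Finset.mem_range_succ_iff.mpr (beta1d_le hn (d.1 + 1))
  rw [ERprob, ← Finset.sum_fiberwise_of_maps_to hmaps, Finset.sum_congr rfl hfiber,
    ← Finset.sum_fiberwise_of_maps_to hJ]
  refine Finset.sum_congr rfl fun j _ => ?_
  rw [hNMon, Finset.sum_congr rfl fun I hI => by rw [(Finset.mem_filter.mp hI).2],
    Finset.sum_const, nsmul_eq_mul, mul_assoc]

end
end

section
/- Let 𝔍 be the random monomial ideal of the ER-type model with parameter p ∈ (0,1). Then the probability that the quotient ring S/𝔍 has Krull dimension n−1 equals −(1−p)^{C(n+D,n)−1} + Σ_{j=1}^{n} (−1)^{j−1} · C(n,j) · (1−p)^{C(n+D,n)−1−C(n+D−j,n)}, where C(a,b) denotes the binomial coefficient 'a choose b'. -/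
open Finset MvPolynomial Filter

noncomputable section

theorem mono_ne_zero (K : Type*) [Field K] {n : ℕ} (α : Fin n → ℕ) : mono K α ≠ 0 := by
  simp [mono]

theorem mono_eq_prod_X_pow (K : Type*) [CommRing K] {n : ℕ} (α : Fin n → ℕ) :
    mono K α = ∏ i, X i ^ α i := by
  simp [mono, monomial_eq, Finsupp.prod_fintype]

theorem exists_X_mem_of_mono_mem {K : Type*} [CommRing K] {n : ℕ} {α : Fin n → ℕ}
    {P : Ideal (MvPolynomial (Fin n) K)} [hP : P.IsPrime] (h : mono K α ∈ P) :
    ∃ i, 0 < α i ∧ (X i : MvPolynomial (Fin n) K) ∈ P := by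
  rw [mono_eq_prod_X_pow, hP.prod_mem_iff] at h
  obtain ⟨i, -, hi⟩ := h
  refine ⟨i, Nat.pos_of_ne_zero fun h0 => ?_, hP.mem_of_pow_mem _ hi⟩
  rw [h0, pow_zero] at hi
  exact hP.ne_top ((Ideal.eq_top_iff_one _).2 hi)

theorem ringKrullDim_mvPolynomial_fin (K : Type*) [Field K] (n : ℕ) :
    ringKrullDim (MvPolynomial (Fin n) K) = n := by
  simp

theorem ringKrullDim_quotient_add_one_le {K : Type*} [Field K] {n : ℕ}
    {I : Ideal (MvPolynomial (Fin n) K)} (hI : I ≠ ⊥) :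
    ringKrullDim (MvPolynomial (Fin n) K ⧸ I) + 1 ≤ n := by
  obtain ⟨r, hr, hr0⟩ := Submodule.exists_mem_ne_zero_of_ne_bot hI
  rw [← ringKrullDim_mvPolynomial_fin K n]
  exact ringKrullDim_succ_le_of_surjective (Ideal.Quotient.mk I) Ideal.Quotient.mk_surjective
    (mem_nonZeroDivisors_of_ne_zero hr0) (Ideal.Quotient.eq_zero_iff_mem.2 hr)

theorem le_ringKrullDim_quotient_of_forall_pos {K : Type*} [Field K] {m : ℕ}
    {B : Finset (Fin (m + 1) → ℕ)} (i : Fin (m + 1)) (h : ∀ α ∈ B, 0 < α i) :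
    (m : WithBot (WithTop ℕ)) ≤ ringKrullDim (MvPolynomial (Fin (m + 1)) K ⧸ idealOf K B) := by
  let f : MvPolynomial (Fin (m + 1)) K →ₐ[K] MvPolynomial (Fin m) K :=
    aeval (i.insertNth 0 X)
  have hf : Function.Surjective f := fun q => ⟨rename i.succAbove q, by
    simp [f, bind₁_rename, Function.comp_def]⟩
  have hker : ∀ a ∈ idealOf K B, f.toRingHom a = 0 := by
    suffices idealOf K B ≤ RingHom.ker f.toRingHom from fun a ha => this ha
    rw [idealOf, Ideal.span_le]
    rintro _ ⟨α, hα, rfl⟩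
    rw [SetLike.mem_coe, RingHom.mem_ker, mono_eq_prod_X_pow, map_prod]
    exact Finset.prod_eq_zero (mem_univ i) (by simp [f, (h α hα).ne'])
  have := ringKrullDim_le_of_surjective _
    (Ideal.Quotient.lift_surjective_of_surjective (idealOf K B) hker hf)
  rwa [ringKrullDim_mvPolynomial_fin] at this

theorem exists_forall_pos_of_le_ringKrullDim_quotient {K : Type*} [Field K] {m : ℕ}
    {B : Finset (Fin (m + 1) → ℕ)} (hB : B.Nonempty)
    (h : (m : WithBot (WithTop ℕ)) ≤ ringKrullDim (MvPolynomial (Fin (m + 1)) K ⧸ idealOf K B)) :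
    ∃ i, ∀ α ∈ B, 0 < α i := by
  by_contra! hne
  rw [ringKrullDim_quotient] at h
  obtain ⟨l, hl⟩ := Order.le_krullDim_iff.1 h
  have hmem : ∀ α ∈ B, mono K α ∈ l.head.1.asIdeal := fun α hα =>
    l.head.2 (Ideal.subset_span ⟨α, hα, rfl⟩)
  obtain ⟨β, hβ⟩ := hB
  obtain ⟨i, -, hi⟩ := exists_X_mem_of_mono_mem (hmem β hβ)
  obtain ⟨α, hα, hαi⟩ := hne i
  obtain ⟨j, hj0, hj⟩ := exists_X_mem_of_mono_mem (hmem α hα)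
  let p : PrimeSpectrum (MvPolynomial (Fin (m + 1)) K) :=
    ⟨Ideal.span {X i}, (Ideal.span_singleton_prime (X_ne_zero i)).2 (X_prime)⟩
  have hp : p < l.head.1 := by
    refine lt_of_le_of_ne ((Ideal.span_singleton_le_iff_mem _).2 hi) fun heq => ?_
    rw [← heq, Ideal.mem_span_singleton, X_dvd_X] at hj
    subst hj
    omega
  let q : PrimeSpectrum (MvPolynomial (Fin (m + 1)) K) := ⟨⊥, Ideal.isPrime_bot⟩
  have hq : q < p := by
    refine lt_of_le_of_ne (bot_le (a := p.asIdeal)) fun heq => ?_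
    have : (⊥ : Ideal _) = p.asIdeal := congrArg PrimeSpectrum.asIdeal heq
    exact X_ne_zero (R := K) i (Ideal.span_singleton_eq_bot.1 this.symm)
  let l' : LTSeries (PrimeSpectrum (MvPolynomial (Fin (m + 1)) K)) :=
    ((l.map Subtype.val fun _ _ => id).cons p hp).cons q hq
  have hl' : l'.length = m + 1 + 1 :=
    (RelSeries.cons_length _ _ _).trans
      (congrArg (· + 1) ((RelSeries.cons_length _ _ _).trans (congrArg (· + 1) hl)))
  have hlen := Order.LTSeries.length_le_krullDim l'
  rw [← ringKrullDim, ringKrullDim_mvPolynomial_fin, hl', Nat.cast_le] at hlen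
  omega

theorem ringKrullDim_quotient_idealOf_eq_iff {K : Type*} [Field K] {m : ℕ}
    {B : Finset (Fin (m + 1) → ℕ)} :
    ringKrullDim (MvPolynomial (Fin (m + 1)) K ⧸ idealOf K B) = (m : WithBot (WithTop ℕ)) ↔
      B.Nonempty ∧ ∃ i, ∀ α ∈ B, 0 < α i := by
  constructor
  · intro h
    have hB : B.Nonempty := by
      by_contra hB
      rw [Finset.not_nonempty_iff_eq_empty] at hB
      subst hB
      have e : idealOf K (∅ : Finset (Fin (m + 1) → ℕ)) = ⊥ := by simp [idealOf]
      rw [e, RingEquiv.ringKrullDim (RingEquiv.quotientBot _),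
        ringKrullDim_mvPolynomial_fin] at h
      exact absurd (Nat.cast_injective h) (by omega)
    exact ⟨hB, exists_forall_pos_of_le_ringKrullDim_quotient hB h.ge⟩
  · rintro ⟨⟨α, hα⟩, i, hi⟩
    refine le_antisymm ?_ (le_ringKrullDim_quotient_of_forall_pos i hi)
    have hI : idealOf K B ≠ ⊥ := fun h0 =>
      mono_ne_zero K α (by
        have : mono K α ∈ idealOf K B := Ideal.subset_span ⟨α, hα, rfl⟩
        rwa [h0] at this)
    have := ringKrullDim_quotient_add_one_le hI
    rw [Nat.cast_add, Nat.cast_one] at this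
    exact (WithBot.add_le_add_iff_right' (c := 1)
      WithBot.one_ne_bot (WithBot.coe_injective.ne ENat.one_ne_top)).1 this

theorem sum_powerset_pow_card_mul {α : Type*} (M : Finset α) {U : Finset α} (hU : U ⊆ M) (p : ℝ) :
    ∑ B ∈ U.powerset, p ^ #B * (1 - p) ^ (#M - #B) = (1 - p) ^ (#M - #U) := by
  have hUM := card_le_card hU
  calc ∑ B ∈ U.powerset, p ^ #B * (1 - p) ^ (#M - #B)
      = (1 - p) ^ (#M - #U) * ∑ B ∈ U.powerset, p ^ #B * (1 - p) ^ (#U - #B) := by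
        rw [mul_sum]
        refine sum_congr rfl fun B hB => ?_
        have := card_le_card (mem_powerset.1 hB)
        rw [mul_left_comm, ← pow_add]
        congr 2
        omega
    _ = (1 - p) ^ (#M - #U) := by
        rw [Finset.sum_pow_mul_eq_add_pow]
        simp

/-- The exponent vectors in `n` variables of total degree at most `D`. -/
def expSimplex (n D : ℕ) : Finset (Fin n → ℕ) :=
  (Fintype.piFinset fun _ : Fin n => Finset.range (D + 1)).filter fun α => ∑ i, α i ≤ D

theorem mem_expSimplex {n D : ℕ} {α : Fin n → ℕ} : α ∈ expSimplex n D ↔ ∑ i, α i ≤ D := by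
  simp only [expSimplex, mem_filter, Fintype.mem_piFinset, mem_range, and_iff_right_iff_imp]
  intro h i
  have := Finset.single_le_sum (f := α) (fun _ _ => Nat.zero_le _) (mem_univ i)
  omega

theorem card_piAntidiag_fin (m d : ℕ) :
    #(piAntidiag (univ : Finset (Fin (m + 1))) d) = (d + m).choose m := by
  have := card_finsuppAntidiag_nat_eq_choose (s := (univ : Finset (Fin (m + 1)))) d
  simp only [finsuppAntidiag, card_map, card_attach, card_univ, Fintype.card_fin] at this
  rw [this, show m + 1 + d - 1 = d + m by omega, Nat.choose_symm_add]

theorem card_expSimplex (m D : ℕ) : #(expSimplex (m + 1) D) = (m + 1 + D).choose (m + 1) := by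
  rw [card_eq_sum_card_fiberwise (f := fun α => ∑ i, α i) (t := range (D + 1))
    (fun α hα => by have := mem_expSimplex.1 hα; simpa [Nat.lt_succ_iff] using this)]
  rw [show m + 1 + D = D + m + 1 by ring, ← Nat.sum_range_add_choose]
  refine sum_congr rfl fun d hd => ?_
  rw [← card_piAntidiag_fin]
  congr 1
  ext α
  simp only [mem_filter, mem_expSimplex, mem_piAntidiag, mem_univ, implies_true, and_true,
    mem_range] at hd ⊢
  exact ⟨fun h => h.2, fun h => ⟨h.trans_le (by omega), h⟩⟩

theorem card_monSet (m D : ℕ) : #(monSet (m + 1) D) = (m + 1 + D).choose (m + 1) - 1 := by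
  have : monSet (m + 1) D = (expSimplex (m + 1) D).erase 0 := by
    ext α
    simp [mem_monSet, mem_expSimplex, Nat.pos_iff_ne_zero, funext_iff]
  rw [this, card_erase_of_mem (by simp [mem_expSimplex]), card_expSimplex]

theorem card_filter_monSet_forall_pos {m D : ℕ} {T : Finset (Fin (m + 1))} (hT : T.Nonempty) :
    #{α ∈ monSet (m + 1) D | ∀ i ∈ T, 0 < α i} = (m + 1 + D - #T).choose (m + 1) := by
  set e : Fin (m + 1) → ℕ := fun i => if i ∈ T then 1 else 0
  have he : ∑ i, e i = #T := by simp [e]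
  have hpos : 0 < #T := hT.card_pos
  by_cases hTD : #T ≤ D
  · rw [Nat.add_sub_assoc hTD, ← card_expSimplex]
    symm
    refine card_bij' (fun α _ => α + e) (fun α _ => α - e) ?_ ?_ ?_ ?_
    · intro α hα
      rw [mem_expSimplex] at hα
      simp only [mem_filter, mem_monSet, Pi.add_apply, sum_add_distrib, he]
      refine ⟨⟨by omega, by omega⟩, fun i hi => by simp [e, hi]⟩
    · intro α hα
      simp only [mem_filter, mem_monSet] at hα
      have hle : ∀ i, e i ≤ α i := fun i => by
        by_cases hi : i ∈ T
        · simpa [e, hi] using Nat.succ_le_of_lt (hα.2 i hi)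
        · simp [e, hi]
      rw [mem_expSimplex]
      simp only [Pi.sub_apply]
      rw [sum_tsub_distrib _ fun i _ => hle i, he]
      omega
    · intro α hα
      simp
    · intro α hα
      simp only [mem_filter, mem_monSet] at hα
      ext i
      by_cases hi : i ∈ T
      · simpa [e, hi] using Nat.sub_add_cancel (hα.2 i hi)
      · simp [e, hi]
  · rw [Nat.choose_eq_zero_of_lt (by omega), card_eq_zero, filter_eq_empty_iff]
    intro α hα hall
    rw [mem_monSet] at hα
    have : ∑ i, e i ≤ ∑ i, α i := sum_le_sum fun i _ => by
      by_cases hi : i ∈ T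
      · simpa [e, hi] using Nat.succ_le_of_lt (hall i hi)
      · simp [e, hi]
    omega

theorem inf'_powerset_filter {α ι : Type*} [DecidableEq α] (M : Finset α) (P : ι → α → Prop)
    [∀ i, DecidablePred (P i)] {T : Finset ι} [DecidablePred fun a => ∀ i ∈ T, P i a]
    (hT : T.Nonempty) :
    T.inf' hT (fun i => {a ∈ M | P i a}.powerset) = {a ∈ M | ∀ i ∈ T, P i a}.powerset := by
  ext B
  rw [← singleton_subset_iff, le_inf'_iff]
  simp only [singleton_subset_iff, mem_powerset]
  simp only [subset_iff, mem_filter]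
  obtain ⟨j, hj⟩ := hT
  exact ⟨fun h a ha => ⟨(h j hj ha).1, fun i hi => (h i hi ha).2⟩,
    fun h i hi a ha => ⟨(h ha).1, (h ha).2 i hi⟩⟩

/-- Theorem 3.2(c). Under the ER-type model, `P(dim S/𝔍 = n-1)` equals
`-(1-p)^{C(n+D,n)-1} + Σ_{j=1}^{n} (-1)^{j-1} C(n,j) (1-p)^{C(n+D,n)-1-C(n+D-j,n)}`. -/
theorem stmt6 (K : Type*) [Field K] (n D : ℕ) (hn : 1 ≤ n) (hD : 1 ≤ D)
    (p : ℝ) (hp0 : 0 < p) (hp1 : p < 1) :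
    ERprob n D p {B | ringKrullDim (MvPolynomial (Fin n) K ⧸ idealOf K B)
        = ((n - 1 : ℕ) : WithBot (WithTop ℕ))} =
      -(1 - p) ^ ((n + D).choose n - 1) +
        ∑ j ∈ Finset.Icc 1 n, (-1 : ℝ) ^ (j - 1) * (n.choose j : ℝ)
          * (1 - p) ^ ((n + D).choose n - 1 - (n + D - j).choose n) := by
  classical
  obtain ⟨m, rfl⟩ : ∃ m, n = m + 1 := ⟨n - 1, by omega⟩
  rw [Nat.add_sub_cancel]
  set M := monSet (m + 1) D
  let S : Fin (m + 1) → Finset (Finset (Fin (m + 1) → ℕ)) := fun i => {α ∈ M | 0 < α i}.powerset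
  let w : Finset (Fin (m + 1) → ℕ) → ℝ := fun B => p ^ #B * (1 - p) ^ (#M - #B)
  have hevent : M.powerset.filter (· ∈ {B | ringKrullDim (MvPolynomial (Fin (m + 1)) K ⧸
      idealOf K B) = (m : WithBot (WithTop ℕ))}) = (univ.biUnion S).erase ∅ := by
    ext B
    simp only [mem_filter, mem_powerset, Set.mem_ofPred_eq, ringKrullDim_quotient_idealOf_eq_iff,
      mem_erase, mem_biUnion, mem_univ, true_and, S, subset_iff, ← nonempty_iff_ne_empty]
    exact ⟨fun ⟨hM, hB, i, hi⟩ => ⟨hB, i, fun α hα => ⟨hM hα, hi α hα⟩⟩,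
      fun ⟨hB, i, hi⟩ => ⟨fun α hα => (hi hα).1, hB, i, fun α hα => (hi hα).2⟩⟩
  have hempty : ∅ ∈ univ.biUnion S := by simp [S]
  have hunion : ∑ B ∈ univ.biUnion S, w B = ∑ j ∈ Finset.Icc 1 (m + 1),
      (-1 : ℝ) ^ (j - 1) * ((m + 1).choose j : ℝ)
        * (1 - p) ^ ((m + 1 + D).choose (m + 1) - 1 - (m + 1 + D - j).choose (m + 1)) := by
    let g : ℕ → ℝ := fun j => if j = 0 then 0 else
      (-1 : ℝ) ^ (j - 1) *
        (1 - p) ^ ((m + 1 + D).choose (m + 1) - 1 - (m + 1 + D - j).choose (m + 1))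
    calc ∑ B ∈ univ.biUnion S, w B
        = ∑ t : (univ : Finset (Fin (m + 1))).powerset.filter (·.Nonempty), g #t.1 := by
          rw [inclusion_exclusion_sum_biUnion]
          refine sum_congr rfl fun t _ => ?_
          have ht := (mem_filter.1 t.2).2
          have hc := ht.card_pos
          simp only [S, g, w, if_neg hc.ne']
          rw [inf'_powerset_filter, sum_powerset_pow_card_mul M (filter_subset _ _),
            card_filter_monSet_forall_pos ht, card_monSet]
          obtain ⟨c, hc'⟩ : ∃ c, #t.1 = c + 1 := ⟨#t.1 - 1, by omega⟩
          simp [hc', pow_succ]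
      _ = ∑ t ∈ (univ : Finset (Fin (m + 1))).powerset, g #t := by
          rw [sum_coe_sort ((univ : Finset (Fin (m + 1))).powerset.filter (·.Nonempty))
            (fun t => g #t)]
          refine sum_subset (filter_subset _ _) fun t ht htn => ?_
          have : t = ∅ := by simpa [ht, not_nonempty_iff_eq_empty] using htn
          simp [this, g]
      _ = _ := by
          rw [sum_powerset_apply_card, card_univ, Fintype.card_fin, range_eq_Ico,
            sum_eq_sum_Ico_succ_bot (by omega)]
          simp only [g, if_true, smul_zero, zero_add]
          refine sum_congr (by ext; simp) fun j hj => ?_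
          rw [mem_Icc] at hj
          rw [if_neg (by omega), nsmul_eq_mul]
          ring
  have h0 := add_sum_erase _ w hempty
  have hw0 : w ∅ = (1 - p) ^ ((m + 1 + D).choose (m + 1) - 1) := by simp [w, M, card_monSet]
  rw [ERprob, hevent, ← hunion, ← hw0, ← h0]
  ring

end
end
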